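/- arXiv:2507.05958 — 7 statements merged into one kernel-verified Lean document; each statement's English description precedes it below -/
import Mathlib

section
/- Let P and Q be probability measures on a measurable space with P ≪ Q, let w = dP/dQ denote the Radon–Nikodym derivative, and let S be a nonnegative measurable function such that √S is P-integrable. Then ∫ w(x) · S(x) dP(x) ≥ (∫ √(S(x)) dP(x))². -/
open MeasureTheory

/-- Over a probability measure, the square of the mean is at most the mean of the square. -/
theorem sq_lintegral_le_lintegral_sq {Ω : Type*} [MeasurableSpace Ω] (μ : Measure Ω)
    [IsProbabilityMeasure μ] {f : Ω → ENNReal} (hf : AEMeasurable f μ) :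
    (∫⁻ x, f x ∂μ) ^ 2 ≤ ∫⁻ x, f x ^ 2 ∂μ := by
  have h := ENNReal.lintegral_mul_le_Lp_mul_Lq μ Real.HolderConjugate.two_two hf
    (aemeasurable_const (b := (1 : ENNReal)))
  simp only [Pi.mul_apply, mul_one, ENNReal.rpow_ofNat, one_pow, lintegral_const, measure_univ,
    ENNReal.one_rpow] at h
  calc (∫⁻ x, f x ∂μ) ^ 2 ≤ ((∫⁻ x, f x ^ 2 ∂μ) ^ (1 / 2 : ℝ)) ^ 2 := by gcongr
    _ = ∫⁻ x, f x ^ 2 ∂μ := by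
      rw [← ENNReal.rpow_natCast, ← ENNReal.rpow_mul]
      norm_num

/-- For probability measures `P ≪ Q` with Radon–Nikodym derivative `w = dP/dQ`
and a nonnegative measurable `S` with `√S` P-integrable,
`∫ w · S dP ≥ (∫ √S dP)²` (the left-hand side possibly infinite). -/
theorem lintegral_rnDeriv_mul_ge_sq_integral_sqrt
    {Ω : Type*} [MeasurableSpace Ω] (P Q : Measure Ω)
    [IsProbabilityMeasure P] [IsProbabilityMeasure Q] (hPQ : P ≪ Q)
    (S : Ω → ℝ) (hSm : Measurable S) (hS0 : ∀ x, 0 ≤ S x)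
    (hint : Integrable (fun x => Real.sqrt (S x)) P) :
    ENNReal.ofReal ((∫ x, Real.sqrt (S x) ∂P) ^ 2)
      ≤ ∫⁻ x, P.rnDeriv Q x * ENNReal.ofReal (S x) ∂P := by
  have hw : Measurable (P.rnDeriv Q) := Measure.measurable_rnDeriv P Q
  have hg : Measurable fun x => ENNReal.ofReal √(S x) := by fun_prop
  rw [ENNReal.ofReal_pow (integral_nonneg fun x => Real.sqrt_nonneg _),
    ofReal_integral_eq_lintegral_ofReal hint (ae_of_all _ fun x => Real.sqrt_nonneg _),
    ← lintegral_rnDeriv_mul hPQ hg.aemeasurable,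
    ← lintegral_rnDeriv_mul hPQ (by fun_prop)]
  refine (sq_lintegral_le_lintegral_sq Q (hw.mul hg).aemeasurable).trans_eq
    (lintegral_congr fun x => ?_)
  rw [Pi.mul_apply, mul_pow, ← ENNReal.ofReal_pow (Real.sqrt_nonneg _), Real.sq_sqrt (hS0 x), sq,
    mul_assoc]
end

section
/- Let P be a probability measure on a measurable space and S a measurable function with S(x) > 0 for P-almost every x and √S P-integrable, with c := ∫ √S dP > 0. Define the measure Q* with density √S / c with respect to P. Then Q* is a probability measure, P ≪ Q*, the Radon–Nikodym derivative satisfies dP/dQ* = c/√S P-almost everywhere, and ∫ (dP/dQ*)(x) · S(x) dP(x) = (∫ √(S(x)) dP(x))². -/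
open MeasureTheory

/-- For a probability measure `P` and `S > 0` P-a.e. with `√S` P-integrable and
`c = ∫ √S dP > 0`, the measure `Q* = P.withDensity (√S / c)` is a probability measure,
`P ≪ Q*`, `dP/dQ* = c/√S` P-a.e., and `∫ (dP/dQ*) · S dP = (∫ √S dP)²`. -/
theorem optimal_marginal_attains_bound
    {Ω : Type*} [MeasurableSpace Ω] (P : Measure Ω) [IsProbabilityMeasure P]
    (S : Ω → ℝ) (hSm : Measurable S) (hSpos : ∀ᵐ x ∂P, 0 < S x)
    (hint : Integrable (fun x => Real.sqrt (S x)) P)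
    (c : ℝ) (hc : c = ∫ x, Real.sqrt (S x) ∂P) (hcpos : 0 < c)
    (Qstar : Measure Ω)
    (hQstar : Qstar = P.withDensity (fun x => ENNReal.ofReal (Real.sqrt (S x) / c))) :
    IsProbabilityMeasure Qstar ∧ P ≪ Qstar ∧
      (P.rnDeriv Qstar =ᵐ[P] fun x => ENNReal.ofReal (c / Real.sqrt (S x))) ∧
      ∫⁻ x, P.rnDeriv Qstar x * ENNReal.ofReal (S x) ∂P
        = ENNReal.ofReal ((∫ x, Real.sqrt (S x) ∂P) ^ 2) := by
  have hmeas : Measurable fun x => ENNReal.ofReal (Real.sqrt (S x) / c) :=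
    (hSm.sqrt.div_const c).ennreal_ofReal
  have hne : ∀ᵐ x ∂P, ENNReal.ofReal (Real.sqrt (S x) / c) ≠ 0 := by
    filter_upwards [hSpos] with x hx
    exact (ENNReal.ofReal_pos.2 (div_pos (Real.sqrt_pos.2 hx) hcpos)).ne'
  have hprob : IsProbabilityMeasure Qstar := by
    refine ⟨?_⟩
    rw [hQstar, withDensity_apply _ MeasurableSet.univ, Measure.restrict_univ,
      ← ofReal_integral_eq_lintegral_ofReal (hint.div_const c)
        (ae_of_all _ fun x => div_nonneg (Real.sqrt_nonneg _) hcpos.le),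
      integral_div, ← hc, div_self hcpos.ne', ENNReal.ofReal_one]
  have hac : P ≪ Qstar := hQstar ▸ withDensity_absolutelyContinuous' hmeas.aemeasurable hne
  have hderiv : P.rnDeriv Qstar =ᵐ[P] fun x => ENNReal.ofReal (c / Real.sqrt (S x)) := by
    have hright := Measure.rnDeriv_withDensity_right P P hmeas.aemeasurable hne
      (ae_of_all _ fun _ => ENNReal.ofReal_ne_top)
    rw [← hQstar] at hright
    filter_upwards [hright, P.rnDeriv_self, hSpos] with x hx hself hS
    rw [hx, hself, mul_one,
      ← ENNReal.ofReal_inv_of_pos (div_pos (Real.sqrt_pos.2 hS) hcpos), inv_div]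
  refine ⟨hprob, hac, hderiv, ?_⟩
  calc ∫⁻ x, P.rnDeriv Qstar x * ENNReal.ofReal (S x) ∂P
      = ∫⁻ x, ENNReal.ofReal (c * Real.sqrt (S x)) ∂P := by
        refine lintegral_congr_ae ?_
        filter_upwards [hderiv, hSpos] with x hx hS
        rw [hx, ← ENNReal.ofReal_mul (div_nonneg hcpos.le (Real.sqrt_nonneg _)),
          div_mul_eq_mul_div, mul_div_assoc, Real.div_sqrt]
    _ = ENNReal.ofReal ((∫ x, Real.sqrt (S x) ∂P) ^ 2) := by
        rw [← ofReal_integral_eq_lintegral_ofReal (hint.const_mul c)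
          (ae_of_all _ fun x => mul_nonneg hcpos.le (Real.sqrt_nonneg _)),
          integral_const_mul, ← hc, sq]
end

section
/- Let κ be a probability measure on a measurable space β and φ : β → (0, ∞) a measurable function that is κ-integrable with c := ∫ φ dκ > 0. Define the measure λ* := κ with density φ/c (i.e., dλ*/dκ = φ/c). Then λ* is a probability measure, κ ≪ λ*, the Radon–Nikodym derivative satisfies dκ/dλ* = c/φ κ-almost everywhere, and ∫ (dκ/dλ*)(y) · φ(y)² dκ(y) = (∫ φ(y) dκ(y))². -/
open MeasureTheory

/-- Sliced (conditional) version of the optimal IS distribution: for a probability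
measure `κ` and a positive measurable `φ` that is `κ`-integrable with `c = ∫ φ dκ > 0`, the
measure `λ* = κ.withDensity (φ/c)` is a probability measure, `κ ≪ λ*`, `dκ/dλ* = c/φ` κ-a.e.,
and `∫ (dκ/dλ*) · φ² dκ = (∫ φ dκ)²`. -/
theorem optimal_conditional_attains_bound
    {β : Type*} [MeasurableSpace β] (κ : Measure β) [IsProbabilityMeasure κ]
    (φ : β → ℝ) (hφm : Measurable φ) (hφpos : ∀ y, 0 < φ y)
    (hint : Integrable φ κ)
    (c : ℝ) (hc : c = ∫ y, φ y ∂κ) (hcpos : 0 < c)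
    (lamstar : Measure β)
    (hlam : lamstar = κ.withDensity (fun y => ENNReal.ofReal (φ y / c))) :
    IsProbabilityMeasure lamstar ∧ κ ≪ lamstar ∧
      (κ.rnDeriv lamstar =ᵐ[κ] fun y => ENNReal.ofReal (c / φ y)) ∧
      ∫⁻ y, κ.rnDeriv lamstar y * ENNReal.ofReal (φ y ^ 2) ∂κ
        = ENNReal.ofReal ((∫ y, φ y ∂κ) ^ 2) := by
  subst hlam
  have hpos : ∀ y, 0 < φ y / c := fun y => div_pos (hφpos y) hcpos
  have hm : Measurable fun y => ENNReal.ofReal (φ y / c) :=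
    (hφm.div_const c).ennreal_ofReal
  have hprob : IsProbabilityMeasure (κ.withDensity fun y => ENNReal.ofReal (φ y / c)) := by
    constructor
    rw [withDensity_apply _ .univ, Measure.restrict_univ,
      ← ofReal_integral_eq_lintegral_ofReal (hint.div_const c)
      (Filter.Eventually.of_forall fun y => (hpos y).le), integral_div, ← hc,
      div_self hcpos.ne', ENNReal.ofReal_one]
  have hac : κ ≪ κ.withDensity fun y => ENNReal.ofReal (φ y / c) :=
    withDensity_absolutelyContinuous' hm.aemeasurable
      (Filter.Eventually.of_forall fun y => (ENNReal.ofReal_pos.2 (hpos y)).ne')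
  have hrn : κ.rnDeriv (κ.withDensity fun y => ENNReal.ofReal (φ y / c)) =ᵐ[κ]
      fun y => ENNReal.ofReal (c / φ y) := by
    filter_upwards [Measure.inv_rnDeriv' hac, Measure.rnDeriv_withDensity κ hm] with y h₁ h₂
    rw [← h₁, Pi.inv_apply, h₂, ← ENNReal.ofReal_inv_of_pos (hpos y), inv_div]
  refine ⟨hprob, hac, hrn, ?_⟩
  calc ∫⁻ y, κ.rnDeriv (κ.withDensity fun y => ENNReal.ofReal (φ y / c)) y
          * ENNReal.ofReal (φ y ^ 2) ∂κ
      = ∫⁻ y, ENNReal.ofReal (c * φ y) ∂κ := by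
        refine lintegral_congr_ae ?_
        filter_upwards [hrn] with y hy
        rw [hy, ← ENNReal.ofReal_mul (div_pos hcpos (hφpos y)).le]
        congr 1
        have := (hφpos y).ne'
        field_simp
    _ = ENNReal.ofReal ((∫ y, φ y ∂κ) ^ 2) := by
        rw [← ofReal_integral_eq_lintegral_ofReal (hint.const_mul c)
          (Filter.Eventually.of_forall fun y => (mul_pos hcpos (hφpos y)).le),
          integral_const_mul, ← hc, sq]
end

section
/- Let α, β be measurable spaces, P_u and Q_u probability measures on α with P_u ≪ Q_u and w_u = dP_u/dQ_u, and κ, λ Markov kernels from α to β such that κ(x) ≪ λ(x) for Q_u-almost every x, with w̄(x, ·) = d(κ x)/d(λ x). Let Y : α × β → ℝ be measurable with Y(x, ·) integrable with respect to κ(x), set m(x) = ∫_β Y(x, y) d(κ x)(y) and Z(x, y) = √(w_u(x)) · w̄(x, y) · Y(x, y), and assume m² is P_u-integrable. Then ∫_α (∫_β Z(x, y) d(λ x)(y))² dQ_u(x) = ∫_α m(x)² dP_u(x). -/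
open MeasureTheory ProbabilityTheory

/-- Lemma 1, part (ii): with `w_u = dP_u/dQ_u`, `w̄(x,·) = d(κ x)/d(λ x)`,
`Z(x,y) = √(w_u x) · w̄(x,y) · Y(x,y)`, `m(x) = ∫ Y(x,·) d(κ x)` and `m²` `P_u`-integrable,
`∫ (∫ Z(x,·) d(λ x))² dQ_u(x) = ∫ m(x)² dP_u(x)`, i.e. `η_u` is recovered under the sampling
distribution. -/
theorem eta_recovered_under_sampling_distribution
    {α β : Type*} [MeasurableSpace α] [MeasurableSpace β]
    (Pu Qu : Measure α) [IsProbabilityMeasure Pu] [IsProbabilityMeasure Qu]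
    (hPQ : Pu ≪ Qu)
    (κ lam : Kernel α β) [IsMarkovKernel κ] [IsMarkovKernel lam]
    (hκlam : ∀ᵐ x ∂Qu, κ x ≪ lam x)
    (Y : α × β → ℝ) (hY : Measurable Y)
    (hYint : ∀ x, Integrable (fun y => Y (x, y)) (κ x))
    (wu : α → ℝ) (hwu : ∀ x, wu x = (Pu.rnDeriv Qu x).toReal)
    (wbar : α → β → ℝ) (hwbar : ∀ x y, wbar x y = ((κ x).rnDeriv (lam x) y).toReal)
    (m : α → ℝ) (hm : ∀ x, m x = ∫ y, Y (x, y) ∂(κ x))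
    (Z : α → β → ℝ) (hZ : ∀ x y, Z x y = Real.sqrt (wu x) * wbar x y * Y (x, y))
    (hm2 : Integrable (fun x => m x ^ 2) Pu) :
    ∫ x, (∫ y, Z x y ∂(lam x)) ^ 2 ∂Qu = ∫ x, m x ^ 2 ∂Pu := by
  rw [← integral_toReal_rnDeriv_mul hPQ]
  refine integral_congr_ae ?_
  filter_upwards [hκlam] with x hx
  have hinner : ∫ y, Z x y ∂(lam x) = Real.sqrt (wu x) * m x := by
    simp_rw [hZ, hwbar, mul_assoc]
    rw [integral_const_mul, integral_toReal_rnDeriv_mul hx, hm]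
  have hwu_nonneg : 0 ≤ wu x := hwu x ▸ ENNReal.toReal_nonneg
  rw [hinner, mul_pow, Real.sq_sqrt hwu_nonneg, hwu]
end

section
/- Let α, β be measurable spaces, P_u and Q_u probability measures on α with P_u ≪ Q_u and w_u = dP_u/dQ_u, κ, λ Markov kernels from α to β with κ(x) ≪ λ(x) for Q_u-almost every x and w̄(x, ·) = d(κ x)/d(λ x), and let (Γ, ν) be a probability space. Let f : α × β × Γ → ℝ be measurable with all the integrals below finite. Set Z(x, y, w) = √(w_u(x)) · w̄(x, y) · f(x, y, w), m(x) = ∫_β ∫_Γ f(x, y, w) dν(w) d(κ x)(y), φ²(x, y) = ∫_Γ f(x, y, w)² dν(w), and η = ∫_α m(x)² dP_u(x). Then 4 ∫_α (∫_{β×Γ} Z(x,·) d((λ x) ⊗ ν))² · (∫_{β×Γ} Z(x,·)² d((λ x) ⊗ ν)) dQ_u(x) − 3 ∫_α (∫_{β×Γ} Z(x,·) d((λ x) ⊗ ν))⁴ dQ_u(x) − η² = 4 ∫_α w_u(x) m(x)² (∫_β w̄(x, y) φ²(x, y) d(κ x)(y)) dP_u(x) − 3 ∫_α w_u(x) m(x)⁴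 dP_u(x) − η². -/
open MeasureTheory ProbabilityTheory

/-- Under the product of `μ'` and `ν`, the importance-weighted integral of `F` is its iterated
integral under `μ` and `ν`. -/
lemma integral_prod_rnDeriv_mul {β Γ : Type*} [MeasurableSpace β] [MeasurableSpace Γ]
    {μ μ' : Measure β} [SigmaFinite μ] [SigmaFinite μ'] (hμ : μ ≪ μ')
    (ν : Measure Γ) [SFinite ν] (c : ℝ) (F : β × Γ → ℝ)
    (hF : Integrable (fun p => c * (μ.rnDeriv μ' p.1).toReal * F p) (μ'.prod ν)) :
    ∫ p, c * (μ.rnDeriv μ' p.1).toReal * F p ∂(μ'.prod ν)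
      = c * ∫ y, (∫ w, F (y, w) ∂ν) ∂μ := by
  rw [integral_prod _ hF, ← integral_rnDeriv_smul hμ, ← integral_const_mul]
  simp only [integral_const_mul, smul_eq_mul, mul_assoc]

/-- Proposition 3.2: the optimal asymptotic variance
`σ²_{opt,u}(q) = 4 E_q[E_q[Z|X_u]² E_q[Z²|X_u]] − 3 E_q[E_q[Z|X_u]⁴] − η²` for estimating
`η_u` from samples drawn under the sampling distribution `q = Q_u ⊗ λ` can be rewritten
entirely under the reference distribution `p = P_u ⊗ κ` via the importance weights
`w_u = dP_u/dQ_u`, `w̄(x,·) = d(κ x)/d(λ x)`: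
it equals `4 E_p[w_u m² E_p[w̄ φ² | X_u]] − 3 E_p[w_u m⁴] − η²`. -/
theorem asymptotic_variance_rewritten_under_reference
    {α β Γ : Type*} [MeasurableSpace α] [MeasurableSpace β] [MeasurableSpace Γ]
    (Pu Qu : Measure α) [IsProbabilityMeasure Pu] [IsProbabilityMeasure Qu]
    (hPQ : Pu ≪ Qu)
    (κ lam : Kernel α β) [IsMarkovKernel κ] [IsMarkovKernel lam]
    (hκlam : ∀ᵐ x ∂Qu, κ x ≪ lam x)
    (ν : Measure Γ) [IsProbabilityMeasure ν]
    (f : α × β × Γ → ℝ) (hf : Measurable f)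
    (wu : α → ℝ) (hwu : ∀ x, wu x = (Pu.rnDeriv Qu x).toReal)
    (wbar : α → β → ℝ) (hwbar : ∀ x y, wbar x y = ((κ x).rnDeriv (lam x) y).toReal)
    (Z : α → β × Γ → ℝ)
    (hZ : ∀ x p, Z x p = Real.sqrt (wu x) * wbar x p.1 * f (x, p.1, p.2))
    (m : α → ℝ) (hm : ∀ x, m x = ∫ y, (∫ w, f (x, y, w) ∂ν) ∂(κ x))
    (φ2 : α → β → ℝ) (hφ2 : ∀ x y, φ2 x y = ∫ w, f (x, y, w) ^ 2 ∂ν)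
    (η : ℝ) (hη : η = ∫ x, m x ^ 2 ∂Pu)
    -- finiteness of all the integrals below
    (hf1 : ∀ x y, Integrable (fun w => f (x, y, w)) ν)
    (hf2 : ∀ x y, Integrable (fun w => f (x, y, w) ^ 2) ν)
    (hm1 : ∀ᵐ x ∂Pu, Integrable (fun y => ∫ w, f (x, y, w) ∂ν) (κ x))
    (hZ1 : ∀ᵐ x ∂Qu, Integrable (Z x) ((lam x).prod ν))
    (hZ2 : ∀ᵐ x ∂Qu, Integrable (fun p => Z x p ^ 2) ((lam x).prod ν))
    (hφ1 : ∀ᵐ x ∂Pu, Integrable (fun y => wbar x y * φ2 x y) (κ x))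
    (hI1 : Integrable (fun x =>
      (∫ p, Z x p ∂((lam x).prod ν)) ^ 2 * ∫ p, Z x p ^ 2 ∂((lam x).prod ν)) Qu)
    (hI2 : Integrable (fun x => (∫ p, Z x p ∂((lam x).prod ν)) ^ 4) Qu)
    (hI3 : Integrable (fun x =>
      wu x * m x ^ 2 * ∫ y, wbar x y * φ2 x y ∂(κ x)) Pu)
    (hI4 : Integrable (fun x => wu x * m x ^ 4) Pu)
    (hm2 : Integrable (fun x => m x ^ 2) Pu) :
    4 * (∫ x, (∫ p, Z x p ∂((lam x).prod ν)) ^ 2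
            * (∫ p, Z x p ^ 2 ∂((lam x).prod ν)) ∂Qu)
      - 3 * (∫ x, (∫ p, Z x p ∂((lam x).prod ν)) ^ 4 ∂Qu) - η ^ 2
    = 4 * (∫ x, wu x * m x ^ 2 * (∫ y, wbar x y * φ2 x y ∂(κ x)) ∂Pu)
      - 3 * (∫ x, wu x * m x ^ 4 ∂Pu) - η ^ 2 := by
  have hsq : ∀ x, Real.sqrt (wu x) ^ 2 = wu x := fun x =>
    Real.sq_sqrt (hwu x ▸ ENNReal.toReal_nonneg)
  have hmean : ∀ᵐ x ∂Qu, ∫ p, Z x p ∂((lam x).prod ν) = Real.sqrt (wu x) * m x := by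
    filter_upwards [hκlam, hZ1] with x hx hi
    have hZx : Z x = fun p => Real.sqrt (wu x) * ((κ x).rnDeriv (lam x) p.1).toReal
        * f (x, p.1, p.2) := by
      funext p; rw [hZ, hwbar]
    rw [hZx] at hi ⊢
    rw [integral_prod_rnDeriv_mul hx ν _ (fun p => f (x, p.1, p.2)) hi, hm]
  have hsecond : ∀ᵐ x ∂Qu, ∫ p, Z x p ^ 2 ∂((lam x).prod ν)
      = wu x * ∫ y, wbar x y * φ2 x y ∂(κ x) := by
    filter_upwards [hκlam, hZ2] with x hx hi
    have hZx : (fun p => Z x p ^ 2) = fun p => wu x * ((κ x).rnDeriv (lam x) p.1).toReal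
        * (wbar x p.1 * f (x, p.1, p.2) ^ 2) := by
      funext p; rw [hZ, ← hwbar, mul_pow, mul_pow, hsq]; ring
    rw [hZx] at hi ⊢
    rw [integral_prod_rnDeriv_mul hx ν _ (fun p => wbar x p.1 * f (x, p.1, p.2) ^ 2) hi]
    simp only [integral_const_mul, hφ2]
  congr 3
  · rw [← integral_rnDeriv_smul hPQ]
    apply integral_congr_ae
    filter_upwards [hmean, hsecond] with x h1 h2
    rw [h1, h2, mul_pow, hsq, ← hwu, smul_eq_mul]
    ring
  · rw [← integral_rnDeriv_smul hPQ]
    apply integral_congr_ae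
    filter_upwards [hmean] with x h1
    rw [h1, mul_pow, ← hwu, smul_eq_mul, show Real.sqrt (wu x) ^ 4 = wu x ^ 2 by
      rw [← hsq x, ← pow_mul, hsq x]]
    ring
end

section
/- Let P be a probability measure on a measurable space α, κ a Markov kernel from α to a measurable space β, and Y : α × β → ℝ measurable with Y(x,·) and Y(x,·)² integrable with respect to κ(x) for P-almost every x. Set m(x) = ∫_β Y(x, y) d(κ x)(y), S_A(x) = 4 m(x)² ∫_β Y(x, y)² d(κ x)(y) − 3 m(x)⁴, and S_B(x) = 4 m(x)² (∫_β |Y(x, y)| d(κ x)(y))² − 3 m(x)⁴, and assume S_A is P-integrable. Then m(x)⁴ ≤ S_B(x) ≤ S_A(x) for P-almost every x, and (∫_α √(S_B(x)) dP(x))² ≤ ∫_α S_A(x) dP(x). -/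
open MeasureTheory ProbabilityTheory

/-- Jensen's inequality for the square, against an integrable pointwise bound of `g ^ 2`. -/
theorem sq_integral_le_integral_of_sq_le {Ω : Type*} [MeasurableSpace Ω] {μ : Measure Ω}
    [IsProbabilityMeasure μ] {g h : Ω → ℝ} (hh : Integrable h μ) (hgh : ∀ᵐ x ∂μ, g x ^ 2 ≤ h x) :
    (∫ x, g x ∂μ) ^ 2 ≤ ∫ x, h x ∂μ := by
  by_cases hg : Integrable g μ
  · set c := ∫ x, g x ∂μ with hc
    have hle : ∫ x, (2 * c * g x - c ^ 2) ∂μ ≤ ∫ x, h x ∂μ := by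
      apply integral_mono_ae ((hg.const_mul _).sub (integrable_const _)) hh
      filter_upwards [hgh] with x hx
      simp only [Pi.sub_apply]
      nlinarith [sq_nonneg (g x - c)]
    rw [integral_sub (hg.const_mul _) (integrable_const _), integral_const_mul, ← hc] at hle
    simp only [integral_const, probReal_univ, one_smul] at hle
    nlinarith
  · rw [integral_undef hg, zero_pow two_ne_zero]
    apply integral_nonneg_of_ae
    filter_upwards [hgh] with x hx using (sq_nonneg _).trans hx

/-- main variance-reduction theorem in the deterministic setting. With
`m(x) = ∫ Y(x,·) d(κ x)`, `S_A(x) = 4 m² ∫ Y² d(κ x) − 3 m⁴` and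
`S_B(x) = 4 m² (∫ |Y| d(κ x))² − 3 m⁴`, one has `m⁴ ≤ S_B ≤ S_A` P-a.e. and
`(∫ √S_B dP)² ≤ ∫ S_A dP`. -/
theorem variance_reduction_deterministic
    {α β : Type*} [MeasurableSpace α] [MeasurableSpace β]
    (P : Measure α) [IsProbabilityMeasure P]
    (κ : Kernel α β) [IsMarkovKernel κ]
    (Y : α × β → ℝ) (hY : Measurable Y)
    (hYint : ∀ᵐ x ∂P, Integrable (fun y => Y (x, y)) (κ x) ∧
      Integrable (fun y => Y (x, y) ^ 2) (κ x))
    (m SA SB : α → ℝ)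
    (hm : ∀ x, m x = ∫ y, Y (x, y) ∂(κ x))
    (hSA : ∀ x, SA x = 4 * m x ^ 2 * (∫ y, Y (x, y) ^ 2 ∂(κ x)) - 3 * m x ^ 4)
    (hSB : ∀ x, SB x = 4 * m x ^ 2 * (∫ y, |Y (x, y)| ∂(κ x)) ^ 2 - 3 * m x ^ 4)
    (hint : Integrable SA P) :
    (∀ᵐ x ∂P, m x ^ 4 ≤ SB x ∧ SB x ≤ SA x) ∧
      (∫ x, Real.sqrt (SB x) ∂P) ^ 2 ≤ ∫ x, SA x ∂P := by
  have hbounds : ∀ᵐ x ∂P, m x ^ 4 ≤ SB x ∧ SB x ≤ SA x := by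
    filter_upwards [hYint] with x hx
    have hlower : m x ^ 2 ≤ (∫ y, |Y (x, y)| ∂(κ x)) ^ 2 := by
      rw [hm x]
      exact sq_le_sq' (neg_le_of_abs_le abs_integral_le_integral_abs)
        (le_of_abs_le abs_integral_le_integral_abs)
    have hupper : (∫ y, |Y (x, y)| ∂(κ x)) ^ 2 ≤ ∫ y, Y (x, y) ^ 2 ∂(κ x) :=
      sq_integral_le_integral_of_sq_le hx.2 (.of_forall fun y => (sq_abs _).le)
    rw [hSA x, hSB x]
    constructor
    · nlinarith [mul_le_mul_of_nonneg_left hlower (sq_nonneg (m x))]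
    · gcongr
  refine ⟨hbounds, sq_integral_le_integral_of_sq_le hint ?_⟩
  filter_upwards [hbounds] with x hx
  rw [Real.sq_sqrt ((by positivity : 0 ≤ m x ^ 4).trans hx.1)]
  exact hx.2
end

section
/- Let P be a probability measure on a measurable space α, κ a Markov kernel from α to a measurable space β, and f : α × β → (0, ∞) a measurable function such that, for P-almost every x, f(x,·) is κ(x)-integrable with m(x) := ∫_β f(x, y) d(κ x)(y) ∈ (0, ∞), and such that η := ∫_α m(x)² dP(x) ∈ (0, ∞). Then ∫_α (η / m(x)²) · ( 4 m(x)² · ∫_β (m(x)/f(x, y)) · f(x, y)² d(κ x)(y) − 3 m(x)⁴ ) dP(x) − η² = 0. -/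
open MeasureTheory ProbabilityTheory

/-- zero-variance theorem, deterministic case: with the fully adapted optimal
sampling density (weights `w_u = η/m²`, `w̄ = m/f`), the asymptotic variance
`∫ (η/m²)·(4 m² ∫ (m/f)·f² dκ − 3 m⁴) dP − η²` vanishes. -/
theorem zero_variance_optimal_distribution
    {α β : Type*} [MeasurableSpace α] [MeasurableSpace β]
    (P : Measure α) [IsProbabilityMeasure P]
    (κ : Kernel α β) [IsMarkovKernel κ]
    (f : α × β → ℝ) (hf : Measurable f) (hfpos : ∀ p, 0 < f p)
    (m : α → ℝ) (hm : ∀ x, m x = ∫ y, f (x, y) ∂(κ x))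
    (hmint : ∀ᵐ x ∂P, Integrable (fun y => f (x, y)) (κ x) ∧ 0 < m x)
    (hm2 : Integrable (fun x => m x ^ 2) P)
    (η : ℝ) (hη : η = ∫ x, m x ^ 2 ∂P) (hηpos : 0 < η) :
    (∫ x, (η / m x ^ 2) *
        (4 * m x ^ 2 * (∫ y, (m x / f (x, y)) * f (x, y) ^ 2 ∂(κ x)) - 3 * m x ^ 4) ∂P)
      - η ^ 2 = 0 := by
  have inner_eq (x : α) : ∫ y, (m x / f (x, y)) * f (x, y) ^ 2 ∂(κ x) = m x ^ 2 := by
    calc ∫ y, (m x / f (x, y)) * f (x, y) ^ 2 ∂(κ x) = ∫ y, m x * f (x, y) ∂(κ x) := by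
          congr with y
          have := (hfpos (x, y)).ne'
          field_simp
      _ = m x ^ 2 := by rw [integral_const_mul, ← hm, sq]
  have outer_eq : ∫ x, (η / m x ^ 2) *
      (4 * m x ^ 2 * (∫ y, (m x / f (x, y)) * f (x, y) ^ 2 ∂(κ x)) - 3 * m x ^ 4) ∂P
      = ∫ x, η * m x ^ 2 ∂P := by
    refine integral_congr_ae ?_
    filter_upwards [hmint] with x hx
    have := hx.2.ne'
    rw [inner_eq]
    field_simp
    ring
  rw [outer_eq, integral_const_mul, ← hη, sq, sub_self]
end
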